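/- Let γ be a monotonicity-preserving specification and μ± = lim_{Λ↑𝕃} γ_Λ(·|±) the associated extremal measures. For each infinite D ⊂ 𝕃 there exist monotonicity-preserving specifications Γ^{(D,+)} and Γ^{(D,−)} on Ω_D = Ω₀^D such that the projections satisfy μ⁺_D ∈ 𝒢(Γ^{(D,+)}) and μ⁻_D ∈ 𝒢(Γ^{(D,−)}), Γ^{(D,−)}_Λ(f) ≤ Γ^{(D,+)}_Λ(f) pointwise for every increasing f, and Γ^{(D,+)} (resp. Γ^{(D,−)}) can be chosen right (resp. left) continuous. -/

import Mathlib

open MeasureTheory Filter Topology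
open scoped ENNReal MeasureTheory Classical

noncomputable section

/-- The σ-algebra on configuration space generated by the coordinates in `Δ`. -/
def cylinderSigma (Ω₀ : Type*) [MeasurableSpace Ω₀] {ι : Type*} (Δ : Set ι) :
    MeasurableSpace (ι → Ω₀) :=
  MeasurableSpace.comap (fun ω (x : Δ) => ω (x : ι)) MeasurableSpace.pi

/-- The configuration agreeing with `ω` on `S` and with `θ` off `S`. -/
def splice {ι Ω₀ : Type*} (S : Set ι) (ω θ : ι → Ω₀) : ι → Ω₀ :=
  fun x => if x ∈ S then ω x else θ x

/-- A function is local if it is measurable with respect to a finite cylinder σ-algebra. -/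
def IsLocal {ι Ω₀ : Type*} [MeasurableSpace Ω₀] (f : (ι → Ω₀) → ℝ) : Prop :=
  ∃ Δ : Finset ι, Measurable[cylinderSigma Ω₀ (Δ : Set ι)] f

/-- Quasilocality of `f` in the direction `θ`. -/
def QuasilocalInDir {ι Ω₀ : Type*} (θ : ι → Ω₀) (f : (ι → Ω₀) → ℝ) : Prop :=
  ∀ ω, Tendsto (fun S : Finset ι => f (splice (S : Set ι) ω θ)) atTop (𝓝 (f ω))

/-- `f` is quasilocal: a uniform limit of local functions. -/
def IsQuasilocal {ι Ω₀ : Type*} [MeasurableSpace Ω₀] (f : (ι → Ω₀) → ℝ) : Prop :=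
  ∀ ε : ℝ, 0 < ε → ∃ g, IsLocal g ∧ ∀ ω, |f ω - g ω| ≤ ε

/-- A specification: a proper consistent family of probability kernels indexed by
finite subsets of the site space. -/
structure Specification (ι Ω₀ : Type*) [MeasurableSpace Ω₀] where
  k : Finset ι → (ι → Ω₀) → Measure (ι → Ω₀)
  isProb : ∀ Λ ω, IsProbabilityMeasure (k Λ ω)
  meas : ∀ (Λ : Finset ι) (A : Set (ι → Ω₀)), MeasurableSet A →
    Measurable[cylinderSigma Ω₀ ((Λ : Set ι))ᶜ] (fun ω => k Λ ω A)
  proper : ∀ (Λ : Finset ι) (B : Set (ι → Ω₀)),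
    MeasurableSet[cylinderSigma Ω₀ ((Λ : Set ι))ᶜ] B → ∀ ω, k Λ ω B = B.indicator 1 ω
  consistent : ∀ ⦃Λ Λ' : Finset ι⦄, Λ ⊆ Λ' → ∀ ω, (k Λ' ω).bind (k Λ) = k Λ' ω

/-- `γ_Λ f`, the expectation of `f` under the kernel of the specification. -/
def specInt {ι Ω₀ : Type*} [MeasurableSpace Ω₀] (γ : Specification ι Ω₀)
    (Λ : Finset ι) (f : (ι → Ω₀) → ℝ) (ω : ι → Ω₀) : ℝ :=
  ∫ x, f x ∂(γ.k Λ ω)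

/-- DLR consistency of a measure with a specification. -/
def IsGibbs {ι Ω₀ : Type*} [MeasurableSpace Ω₀] (γ : Specification ι Ω₀)
    (μ : Measure (ι → Ω₀)) : Prop :=
  ∀ Λ, μ.bind (γ.k Λ) = μ

/-- A specification is quasilocal in the direction `θ`. -/
def SpecQuasilocalInDir {ι Ω₀ : Type*} [MeasurableSpace Ω₀] (γ : Specification ι Ω₀)
    (θ : ι → Ω₀) : Prop :=
  ∀ Λ f, IsLocal f → QuasilocalInDir θ (specInt γ Λ f)

/-- A quasilocal specification. -/
def IsSpecQuasilocal {ι Ω₀ : Type*} [MeasurableSpace Ω₀] (γ : Specification ι Ω₀) : Prop :=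
  ∀ Λ f, IsLocal f → IsQuasilocal (specInt γ Λ f)

/-- A monotonicity-preserving specification. -/
def MonoPreserving {ι Ω₀ : Type*} [MeasurableSpace Ω₀] [Preorder Ω₀]
    (γ : Specification ι Ω₀) : Prop :=
  ∀ Λ (f : (ι → Ω₀) → ℝ), Measurable f → Monotone f → Monotone (specInt γ Λ f)

/-- `γ'` is the limit of `γ` with boundary condition forced to `θ` outside larger
and larger volumes. -/
def IsDirLimitSpec {ι Ω₀ : Type*} [MeasurableSpace Ω₀] (γ γ' : Specification ι Ω₀)
    (θ : ι → Ω₀) : Prop :=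
  ∀ Λ f, IsLocal f → ∀ ω,
    Tendsto (fun S : Finset ι => specInt γ Λ f (splice (S : Set ι) ω θ)) atTop
      (𝓝 (specInt γ' Λ f ω))

/-- `μ` is the weak limit `lim_{Λ↑𝕃} γ_Λ(⬝|θ)`. -/
def IsLimitWithBoundary {ι Ω₀ : Type*} [MeasurableSpace Ω₀] (γ : Specification ι Ω₀)
    (θ : ι → Ω₀) (μ : Measure (ι → Ω₀)) : Prop :=
  IsProbabilityMeasure μ ∧
    ∀ f, IsLocal f → Tendsto (fun Λ : Finset ι => specInt γ Λ f θ) atTop (𝓝 (∫ ω, f ω ∂μ))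

/-- The set of configurations at which all the `γ_Λ f` (`f` local) are continuous. -/
def contSet {ι Ω₀ : Type*} [MeasurableSpace Ω₀] [TopologicalSpace Ω₀]
    (γ : Specification ι Ω₀) : Set (ι → Ω₀) :=
  {ω | ∀ Λ f, IsLocal f → ContinuousAt (specInt γ Λ f) ω}

/-- An almost quasilocal probability measure. -/
def AlmostQuasilocal {ι Ω₀ : Type*} [MeasurableSpace Ω₀] [TopologicalSpace Ω₀]
    (μ : Measure (ι → Ω₀)) : Prop :=
  ∃ γ : Specification ι Ω₀, IsGibbs γ μ ∧ μ (contSet γ) = 1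

/-- Sites of the lattice `ℤ^d`. -/
abbrev Site (d : ℕ) := Fin d → ℤ

/-- The cube `Λ_n = ([-n,n] ∩ ℤ)^d`. -/
def cube (d : ℕ) (n : ℕ) : Finset (Site d) :=
  Fintype.piFinset fun _ => Finset.Icc (-(n : ℤ)) (n : ℤ)

/-- Translation of a configuration by `i`. -/
def shift {Ω₀ : Type*} {d : ℕ} (i : Site d) (ω : Site d → Ω₀) : Site d → Ω₀ :=
  fun x => ω (x - i)

/-- Translation invariance of a measure. -/
def TransInv {Ω₀ : Type*} [MeasurableSpace Ω₀] {d : ℕ} (μ : Measure (Site d → Ω₀)) : Prop :=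
  ∀ i : Site d, μ.map (shift i) = μ

/-- Translation invariance of a specification. -/
def TransInvSpec {Ω₀ : Type*} [MeasurableSpace Ω₀] {d : ℕ}
    (γ : Specification (Site d) Ω₀) : Prop :=
  ∀ (i : Site d) (Λ : Finset (Site d)) (ω),
    γ.k (Λ.image (· + i)) (shift i ω) = (γ.k Λ ω).map (shift i)

/-- Restriction (projection) of a measure to the coordinates in `Δ`. -/
def restrictTo {ι Ω₀ : Type*} [MeasurableSpace Ω₀] (Δ : Finset ι)
    (μ : Measure (ι → Ω₀)) : Measure ({x // x ∈ Δ} → Ω₀) :=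
  μ.map (fun ω (x : {x // x ∈ Δ}) => ω (x : ι))

/-- The Radon–Nikodym density `dμ_Δ/dν_Δ`, viewed as a function on configuration space. -/
def density {ι Ω₀ : Type*} [MeasurableSpace Ω₀] (Δ : Finset ι)
    (μ ν : Measure (ι → Ω₀)) : (ι → Ω₀) → ℝ :=
  fun ω => ((restrictTo Δ μ).rnDeriv (restrictTo Δ ν) (fun x : {x // x ∈ Δ} => ω (x : ι))).toReal

/-- Relative entropy `H_Δ(μ|ν)` at the finite volume `Δ` (`+∞` if `μ_Δ` is not
absolutely continuous with respect to `ν_Δ`). -/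
def relEnt {ι Ω₀ : Type*} [MeasurableSpace Ω₀] (Δ : Finset ι)
    (μ ν : Measure (ι → Ω₀)) : ℝ≥0∞ :=
  if restrictTo Δ μ ≪ restrictTo Δ ν then
    ENNReal.ofReal (∫ ω, density Δ μ ν ω * Real.log (density Δ μ ν ω) ∂ν)
  else ⊤

/-- Vanishing relative entropy density: `h(μ|ν) = 0`. -/
def EntDensityZero {Ω₀ : Type*} [MeasurableSpace Ω₀] {d : ℕ}
    (μ ν : Measure (Site d → Ω₀)) : Prop :=
  Tendsto (fun n => relEnt (cube d n) μ ν / ((cube d n).card : ℝ≥0∞)) atTop (𝓝 0)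


set_option linter.unusedSectionVars false
section Helpers

variable {ι Ω₀ : Type*} [Fintype Ω₀] [MeasurableSpace Ω₀] [DiscreteMeasurableSpace Ω₀]

lemma cyl_le (Δ : Set ι) : cylinderSigma Ω₀ Δ ≤ (MeasurableSpace.pi : MeasurableSpace (ι → Ω₀)) := by
  unfold cylinderSigma
  rw [← measurable_iff_comap_le]
  exact measurable_pi_lambda _ fun x => measurable_pi_apply _

lemma cyl_mem_iff {Δ : Set ι} {B : Set (ι → Ω₀)} (hB : MeasurableSet[cylinderSigma Ω₀ Δ] B)
    {ω η : ι → Ω₀} (h : ∀ x ∈ Δ, ω x = η x) : ω ∈ B ↔ η ∈ B := by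
  obtain ⟨t, _, rfl⟩ := hB
  have : (fun x : Δ => ω x) = fun x : Δ => η x := by
    funext x; exact h x x.2
  simp only [Set.mem_preimage, this]

lemma cyl_fun_eq {β : Type*} [MeasurableSpace β] [MeasurableSingletonClass β] {Δ : Set ι}
    {f : (ι → Ω₀) → β} (hf : Measurable[cylinderSigma Ω₀ Δ] f)
    {ω η : ι → Ω₀} (h : ∀ x ∈ Δ, ω x = η x) : f ω = f η := by
  have := (cyl_mem_iff (hf (measurableSet_singleton (f η))) h).2 rfl
  exact this

/-- A measurable function depending only on `Δ` is `cylinderSigma`-measurable. -/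
lemma cyl_measurable {β : Type*} [MeasurableSpace β] (θ : Ω₀) {Δ : Set ι}
    {f : (ι → Ω₀) → β} (hf : Measurable f)
    (h : ∀ ω, f ω = f (fun x => if x ∈ Δ then ω x else θ)) :
    Measurable[cylinderSigma Ω₀ Δ] f := by
  have h1 : f = (fun z : Δ → Ω₀ => f (fun x => if h : x ∈ Δ then z ⟨x, h⟩ else θ)) ∘
      (fun (ω : ι → Ω₀) (x : Δ) => ω (x : ι)) := by
    funext ω
    rw [h ω]
    simp
  rw [h1]
  have h2 : Measurable (fun z : Δ → Ω₀ => f (fun x => if h : x ∈ Δ then z ⟨x, h⟩ else θ)) := by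
    refine hf.comp (measurable_pi_lambda _ fun x => ?_)
    by_cases hx : x ∈ Δ
    · simp only [hx, dite_true]; exact measurable_pi_apply _
    · simp only [hx, dite_false]; exact measurable_const
  exact h2.comp (comap_measurable _)

lemma isLocal_iff (θ : Ω₀) (f : (ι → Ω₀) → ℝ) :
    IsLocal f ↔ ∃ Δ : Finset ι, ∃ g : (Δ → Ω₀) → ℝ, f = fun ω => g (fun x => ω x) := by
  constructor
  · rintro ⟨Δ, hΔ⟩
    refine ⟨Δ, fun z => f (fun x => if h : x ∈ Δ then z ⟨x, h⟩ else θ), ?_⟩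
    funext ω
    apply cyl_fun_eq hΔ
    intro x hx
    have hx' : x ∈ Δ := hx
    simp [hx']
  · rintro ⟨Δ, g, rfl⟩
    refine ⟨Δ, ?_⟩
    have hg : Measurable g := measurable_of_finite g
    exact hg.comp (comap_measurable _)

lemma isLocal_of_dep (θ : Ω₀) {f : (ι → Ω₀) → ℝ} (Δ : Finset ι)
    (h : ∀ ω η, (∀ x ∈ Δ, ω x = η x) → f ω = f η) : IsLocal f := by
  rw [isLocal_iff θ]
  refine ⟨Δ, fun z => f (fun x => if h : x ∈ Δ then z ⟨x, h⟩ else θ), ?_⟩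
  funext ω
  apply h
  intro x hx
  simp [hx]

lemma IsLocal.dep {f : (ι → Ω₀) → ℝ} (hf : IsLocal f) :
    ∃ Δ : Finset ι, ∀ ω η, (∀ x ∈ Δ, ω x = η x) → f ω = f η := by
  obtain ⟨Δ, hΔ⟩ := hf
  exact ⟨Δ, fun ω η h => cyl_fun_eq hΔ h⟩

lemma IsLocal.meas {f : (ι → Ω₀) → ℝ} (hf : IsLocal f) : Measurable f := by
  obtain ⟨Δ, hΔ⟩ := hf
  exact hΔ.mono (cyl_le _) le_rfl

lemma IsLocal.bdd (θ : Ω₀) {f : (ι → Ω₀) → ℝ} (hf : IsLocal f) : ∃ C, ∀ ω, |f ω| ≤ C := by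
  obtain ⟨Δ, g, rfl⟩ := (isLocal_iff θ f).1 hf
  obtain ⟨C, hC⟩ := (Set.finite_range fun z => |g z|).bddAbove
  exact ⟨C, fun ω => hC ⟨_, rfl⟩⟩

lemma IsLocal.cont (θ : Ω₀) [TopologicalSpace Ω₀] [DiscreteTopology Ω₀]
    {f : (ι → Ω₀) → ℝ} (hf : IsLocal f) : Continuous f := by
  obtain ⟨Δ, g, rfl⟩ := (isLocal_iff θ f).1 hf
  have hg : Continuous g := continuous_of_discreteTopology
  exact hg.comp (continuous_pi fun x => continuous_apply _)

lemma bdd_integrable {α : Type*} [MeasurableSpace α] {μ : Measure α} [IsFiniteMeasure μ]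
    {f : α → ℝ} (hf : Measurable f) {C : ℝ} (hC : ∀ ω, |f ω| ≤ C) : Integrable f μ :=
  Integrable.of_bound hf.aestronglyMeasurable C (Eventually.of_forall hC)

lemma IsLocal.integrable (θ : Ω₀) {f : (ι → Ω₀) → ℝ} (hf : IsLocal f)
    (μ : Measure (ι → Ω₀)) [IsFiniteMeasure μ] : Integrable f μ := by
  obtain ⟨C, hC⟩ := hf.bdd θ
  exact bdd_integrable hf.meas hC

/-- Every local function is a difference of increasing local functions. -/
lemma IsLocal.decomp [LinearOrder Ω₀] (θ : Ω₀) {f : (ι → Ω₀) → ℝ} (hf : IsLocal f) :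
    ∃ g h : (ι → Ω₀) → ℝ, IsLocal g ∧ IsLocal h ∧ Monotone g ∧ Monotone h ∧
      f = fun ω => g ω - h ω := by
  obtain ⟨C, hC⟩ := hf.bdd θ
  obtain ⟨Δ, hΔ⟩ := hf.dep
  have hC0 : 0 ≤ C := (abs_nonneg _).trans (hC fun _ => θ)
  let r : Ω₀ → ℕ := fun a => (Finset.univ.filter (· < a)).card
  have hr : StrictMono r := by
    intro a b hab
    apply Finset.card_lt_card
    refine Finset.ssubset_iff_subset_ne.2 ⟨fun c hc => ?_, fun he => ?_⟩
    · simp only [Finset.mem_filter, Finset.mem_univ, true_and] at hc ⊢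
      exact hc.trans hab
    · have : a ∈ Finset.univ.filter (· < a) := by rw [he]; simpa using hab
      simp at this
  let s : (ι → Ω₀) → ℕ := fun ω => ∑ x ∈ Δ, r (ω x)
  have hs : Monotone s := fun ω η h => Finset.sum_le_sum fun x _ => hr.monotone (h x)
  have hh : Monotone fun ω => 2 * C * (s ω : ℝ) := fun ω η h => by
    have : (s ω : ℝ) ≤ s η := by exact_mod_cast hs h
    dsimp only
    gcongr
  have hsl : ∀ ω η : ι → Ω₀, (∀ x ∈ Δ, ω x = η x) → s ω = s η := fun ω η h =>
    Finset.sum_congr rfl fun x hx => by rw [h x hx]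
  refine ⟨fun ω => f ω + 2 * C * s ω, fun ω => 2 * C * s ω, ?_, ?_, ?_, hh, ?_⟩
  · exact isLocal_of_dep θ Δ fun ω η h => by simp only [hΔ ω η h, hsl ω η h]
  · exact isLocal_of_dep θ Δ fun ω η h => by simp only [hsl ω η h]
  · intro ω η h
    dsimp only
    by_cases he : ∀ x ∈ Δ, ω x = η x
    · rw [hΔ ω η he, hsl ω η he]
    · push Not at he
      obtain ⟨x, hx, hne⟩ := he
      have h1 : s ω < s η := Finset.sum_lt_sum (fun x _ => hr.monotone (h x))
        ⟨x, hx, hr (lt_of_le_of_ne (h x) hne)⟩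
      have h2 : (s ω : ℝ) + 1 ≤ s η := by exact_mod_cast h1
      have h3 := abs_le.1 (hC ω)
      have h4 := abs_le.1 (hC η)
      nlinarith
  · funext ω; ring

/-- Probability measures agreeing on local increasing functions are equal. -/
lemma ext_of_local [LinearOrder Ω₀] (θ : Ω₀) {μ ν : Measure (ι → Ω₀)} [IsProbabilityMeasure μ]
    [IsProbabilityMeasure ν]
    (h : ∀ f, IsLocal f → Monotone f → ∫ ω, f ω ∂μ = ∫ ω, f ω ∂ν) : μ = ν := by
  have h' : ∀ f, IsLocal f → ∫ ω, f ω ∂μ = ∫ ω, f ω ∂ν := by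
    intro f hf
    obtain ⟨g, k, hg, hk, mg, mk, rfl⟩ := hf.decomp θ
    rw [integral_sub (hg.integrable θ _) (hk.integrable θ _),
      integral_sub (hg.integrable θ _) (hk.integrable θ _), h g hg mg, h k hk mk]
  refine ext_of_generate_finite _ generateFrom_measurableCylinders.symm
    isPiSystem_measurableCylinders ?_ (by simp)
  intro A hA
  obtain ⟨Δ, S, hS, rfl⟩ := (mem_measurableCylinders _).1 hA
  have hm : MeasurableSet (cylinder Δ S : Set (ι → Ω₀)) := hS.cylinder Δ
  have hl : IsLocal ((cylinder Δ S : Set (ι → Ω₀)).indicator (1 : (ι → Ω₀) → ℝ)) := by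
    refine isLocal_of_dep θ Δ fun ω η h => ?_
    have : ω ∈ cylinder Δ S ↔ η ∈ cylinder Δ S := by
      simp only [mem_cylinder]
      have : Δ.restrict ω = Δ.restrict η := by funext x; exact h x x.2
      rw [this]
    by_cases hω : ω ∈ cylinder Δ S
    · simp [hω, this.1 hω]
    · simp [hω, mt this.2 hω]
  have := h' _ hl
  rw [integral_indicator_one hm, integral_indicator_one hm] at this
  exact (measureReal_eq_measureReal_iff).1 this

lemma dom_set [Countable ι] [LinearOrder Ω₀] (θ : Ω₀) {μ ν : Measure (ι → Ω₀)}
    [IsProbabilityMeasure μ] [IsProbabilityMeasure ν]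
    (h : ∀ f, IsLocal f → Monotone f → ∫ ω, f ω ∂μ ≤ ∫ ω, f ω ∂ν)
    {A : Set (ι → Ω₀)} (hA : MeasurableSet A) (hup : IsUpperSet A) : μ A ≤ ν A := by
  let _ : TopologicalSpace Ω₀ := ⊥
  have _ : DiscreteTopology Ω₀ := ⟨rfl⟩
  rw [hA.measure_eq_iSup_isCompact_of_ne_top (measure_ne_top μ A)]
  refine iSup₂_le fun K hKA => iSup_le fun hK => ?_
  let U : Finset ι → Set (ι → Ω₀) := fun Δ => {η | ∃ κ ∈ K, ∀ x ∈ Δ, κ x ≤ η x}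
  have hUanti : Antitone U := by
    rintro Δ Δ' hs η ⟨κ, hκ, hx⟩
    exact ⟨κ, hκ, fun x hxx => hx x (hs hxx)⟩
  have hUloc : ∀ Δ, IsLocal ((U Δ).indicator (1 : (ι → Ω₀) → ℝ)) := by
    intro Δ
    refine isLocal_of_dep θ Δ fun ω η h => ?_
    have : ω ∈ U Δ ↔ η ∈ U Δ := by
      simp only [U, Set.mem_ofPred_eq]
      refine exists_congr fun κ => and_congr_right fun _ => forall₂_congr fun x hx => ?_
      rw [h x hx]
    by_cases hω : ω ∈ U Δ
    · simp [hω, this.1 hω]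
    · simp [hω, mt this.2 hω]
  have hUm : ∀ Δ, MeasurableSet (U Δ) := by
    intro Δ
    have h1 := (hUloc Δ).meas (measurableSet_singleton (1 : ℝ))
    convert h1 using 1
    ext η
    by_cases hη : η ∈ U Δ <;> simp [hη]
  have hUmono : ∀ Δ, Monotone ((U Δ).indicator (1 : (ι → Ω₀) → ℝ)) := by
    intro Δ ω η hle
    by_cases hω : ω ∈ U Δ
    · have hη : η ∈ U Δ := by
        obtain ⟨κ, hκ, hx⟩ := hω
        exact ⟨κ, hκ, fun x hxx => (hx x hxx).trans (hle x)⟩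
      simp [hω, hη]
    · simp only [hω, Set.indicator_of_notMem, not_false_eq_true]
      exact Set.indicator_nonneg (fun _ _ => zero_le_one) _
  have hUle : ∀ Δ, μ K ≤ ν (U Δ) := by
    intro Δ
    have h1 := h _ (hUloc Δ) (hUmono Δ)
    rw [integral_indicator_one (hUm Δ), integral_indicator_one (hUm Δ)] at h1
    have h2 : μ (U Δ) ≤ ν (U Δ) := (ENNReal.toReal_le_toReal (measure_ne_top _ _) (measure_ne_top _ _)).1 h1
    refine le_trans (measure_mono ?_) h2
    intro κ hκ
    exact ⟨κ, hκ, fun _ _ => le_rfl⟩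
  have hlim : Tendsto (fun Δ => ν (U Δ)) atTop (𝓝 (ν (⋂ Δ, U Δ))) :=
    tendsto_measure_iInter_atTop (fun Δ => (hUm Δ).nullMeasurableSet) hUanti
      ⟨∅, measure_ne_top _ _⟩
  refine (ge_of_tendsto' hlim hUle).trans (measure_mono ?_)
  intro η hη
  rw [Set.mem_iInter] at hη
  have hcl : ∀ Δ : Finset ι, IsClosed {κ : ι → Ω₀ | ∀ x ∈ Δ, κ x ≤ η x} := by
    intro Δ
    have : {κ : ι → Ω₀ | ∀ x ∈ Δ, κ x ≤ η x} = ⋂ x ∈ Δ, (fun κ : ι → Ω₀ => κ x) ⁻¹' {a | a ≤ η x} := by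
      ext κ; simp
    rw [this]
    exact isClosed_biInter fun x _ => (isClosed_discrete _).preimage (continuous_apply x)
  obtain ⟨κ, hκ⟩ := IsCompact.nonempty_iInter_of_directed_nonempty_isCompact_isClosed
    (fun Δ : Finset ι => K ∩ {κ : ι → Ω₀ | ∀ x ∈ Δ, κ x ≤ η x})
    (by
      intro Δ Δ'
      refine ⟨Δ ∪ Δ', ?_, ?_⟩
      · rintro κ ⟨h1, h2⟩
        exact ⟨h1, fun x hx => h2 x (Finset.mem_union_left _ hx)⟩
      · rintro κ ⟨h1, h2⟩
        exact ⟨h1, fun x hx => h2 x (Finset.mem_union_right _ hx)⟩)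
    (fun Δ => by
      obtain ⟨κ, h1, h2⟩ := hη Δ
      exact ⟨κ, h1, h2⟩)
    (fun Δ => hK.inter_right (hcl Δ))
    (fun Δ => hK.isClosed.inter (hcl Δ))
  rw [Set.mem_iInter] at hκ
  refine hup (fun x => ?_) (hKA (hκ ∅).1)
  exact (hκ {x}).2 x (by simp)

/-- Stochastic domination on local increasing functions extends to all increasing ones. -/
lemma dom_fun [Countable ι] [LinearOrder Ω₀] [BoundedOrder Ω₀] {μ ν : Measure (ι → Ω₀)}
    [IsProbabilityMeasure μ] [IsProbabilityMeasure ν]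
    (h : ∀ f, IsLocal f → Monotone f → ∫ ω, f ω ∂μ ≤ ∫ ω, f ω ∂ν)
    {f : (ι → Ω₀) → ℝ} (hf : Measurable f) (hm : Monotone f) :
    ∫ ω, f ω ∂μ ≤ ∫ ω, f ω ∂ν := by
  set c := f ⊥ with hc
  have hg0 : ∀ ω, 0 ≤ f ω - c := fun ω => sub_nonneg.2 (hm bot_le)
  have hgm : Measurable fun ω => f ω - c := hf.sub_const c
  have hb : ∀ ω, |f ω| ≤ |f ⊤| + |f ⊥| := fun ω => by
    have h1 : f ω ≤ f ⊤ := hm le_top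
    have h2 : f ⊥ ≤ f ω := hm bot_le
    rw [abs_le]
    constructor
    · have := neg_abs_le (f ⊥); have := abs_nonneg (f ⊤); linarith
    · have := le_abs_self (f ⊤); have := abs_nonneg (f ⊥); linarith
  have iμ : Integrable f μ := bdd_integrable hf hb
  have iν : Integrable f ν := bdd_integrable hf hb
  have key : ∫ ω, (f ω - c) ∂μ ≤ ∫ ω, (f ω - c) ∂ν := by
    rw [integral_eq_lintegral_of_nonneg_ae (Eventually.of_forall hg0) hgm.aestronglyMeasurable,
      integral_eq_lintegral_of_nonneg_ae (Eventually.of_forall hg0) hgm.aestronglyMeasurable]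
    refine ENNReal.toReal_mono ?_ ?_
    · exact (Integrable.lintegral_lt_top (iν.sub (integrable_const c))).ne
    · rw [lintegral_eq_lintegral_meas_lt μ (Eventually.of_forall hg0) hgm.aemeasurable,
        lintegral_eq_lintegral_meas_lt ν (Eventually.of_forall hg0) hgm.aemeasurable]
      refine lintegral_mono fun t => ?_
      refine dom_set ⊤ h (measurableSet_lt measurable_const hgm) ?_
      intro ω η hle hω
      simp only [Set.mem_ofPred_eq] at hω ⊢
      have := hm hle
      linarith
  rw [integral_sub iμ (integrable_const c), integral_sub iν (integrable_const c)] at key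
  simpa using key

lemma spec_ae [Countable ι] (γ : Specification ι Ω₀) (Λ : Finset ι) (ω : ι → Ω₀) :
    ∀ᵐ η ∂γ.k Λ ω, ∀ x, x ∉ Λ → η x = ω x := by
  have := γ.isProb Λ ω
  rw [ae_all_iff]
  intro x
  by_cases hx : x ∈ Λ
  · simp [hx]
  · have hB : MeasurableSet[cylinderSigma Ω₀ ((Λ : Set ι))ᶜ] {η : ι → Ω₀ | η x = ω x} := by
      refine ⟨{z | z ⟨x, hx⟩ = ω x}, ?_, rfl⟩
      exact measurable_pi_apply _ (measurableSet_singleton _)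
    have h1 := γ.proper Λ _ hB ω
    have h2 : ∀ᵐ η ∂γ.k Λ ω, η ∈ {η : ι → Ω₀ | η x = ω x} := by
      refine (mem_ae_iff_prob_eq_one (cyl_le _ _ hB)).2 ?_
      rw [h1]; simp
    filter_upwards [h2] with η hη _ using hη

lemma spec_congr (γ : Specification ι Ω₀) (Λ : Finset ι) {ω ω' : ι → Ω₀}
    (h : ∀ x, x ∉ Λ → ω x = ω' x) : γ.k Λ ω = γ.k Λ ω' := by
  ext A hA
  exact cyl_fun_eq (γ.meas Λ A hA) fun x hx => h x hx

lemma spec_measurable (γ : Specification ι Ω₀) (Λ : Finset ι) : Measurable (γ.k Λ) :=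
  Measure.measurable_of_measurable_coe _ fun A hA => (γ.meas Λ A hA).mono (cyl_le _) le_rfl

lemma integral_bind_kernel {α β : Type*} [MeasurableSpace α] [MeasurableSpace β]
    (μ : Measure α) [IsProbabilityMeasure μ]
    (κ : α → Measure β) (hκ : Measurable κ) (hp : ∀ a, IsProbabilityMeasure (κ a))
    {f : β → ℝ} (hf : Measurable f) {C : ℝ} (hC : ∀ ω, |f ω| ≤ C) :
    Measurable (fun a => ∫ y, f y ∂κ a) ∧
    ∫ y, f y ∂(μ.bind κ) = ∫ a, ∫ y, f y ∂κ a ∂μ := by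
  let K : ProbabilityTheory.Kernel α β := ⟨κ, hκ⟩
  have : ProbabilityTheory.IsMarkovKernel K := ⟨hp⟩
  refine ⟨?_, ?_⟩
  · exact (StronglyMeasurable.integral_kernel (κ := K) hf.stronglyMeasurable).measurable
  · have h := ProbabilityTheory.Kernel.integral_comp (η := K)
      (κ := ProbabilityTheory.Kernel.const Unit μ) (a := ()) (f := f) (bdd_integrable hf hC)
    rw [ProbabilityTheory.Kernel.comp_apply] at h
    exact h

lemma specInt_meas (γ : Specification ι Ω₀) (Λ : Finset ι) {f : (ι → Ω₀) → ℝ}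
    (hf : Measurable f) {C : ℝ} (hC : ∀ ω, |f ω| ≤ C) : Measurable (specInt γ Λ f) := by
  by_cases hne : Nonempty (ι → Ω₀)
  · obtain ⟨ω⟩ := hne
    have := γ.isProb Λ ω
    exact (integral_bind_kernel (γ.k Λ ω) _ (spec_measurable γ Λ) (γ.isProb Λ) hf hC).1
  · have : IsEmpty (ι → Ω₀) := not_nonempty_iff.1 hne
    exact measurable_of_empty _

lemma specInt_bdd (γ : Specification ι Ω₀) (Λ : Finset ι) {f : (ι → Ω₀) → ℝ}
    {C : ℝ} (hC : ∀ ω, |f ω| ≤ C) (ω : ι → Ω₀) : |specInt γ Λ f ω| ≤ C := by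
  have := γ.isProb Λ ω
  have h := norm_integral_le_of_norm_le_const (μ := γ.k Λ ω) (f := f) (Eventually.of_forall hC)
  simpa [specInt] using h

lemma specInt_cons (γ : Specification ι Ω₀) {Λ Λ' : Finset ι} (hs : Λ ⊆ Λ')
    {f : (ι → Ω₀) → ℝ} (hf : Measurable f) {C : ℝ} (hC : ∀ ω, |f ω| ≤ C) (ω : ι → Ω₀) :
    specInt γ Λ' (specInt γ Λ f) ω = specInt γ Λ' f ω := by
  have := γ.isProb Λ' ω
  have h := (integral_bind_kernel (γ.k Λ' ω) _ (spec_measurable γ Λ) (γ.isProb Λ) hf hC).2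
  rw [γ.consistent hs] at h
  exact h.symm

/-- Finite volume `S ∩ V`. -/
def gvol (V : Set ι) (S : Finset ι) : Finset ι := S.filter (· ∈ V)

/-- Boundary condition: `ω` on `S \ V`, and `θ` elsewhere. -/
def gbnd (θ : Ω₀) (V : Set ι) (S : Finset ι) (ω : ι → Ω₀) : ι → Ω₀ :=
  fun x => if x ∈ S ∧ x ∉ V then ω x else θ

/-- Finite volume approximation of the global kernel. -/
def gG (γ : Specification ι Ω₀) (θ : Ω₀) (V : Set ι) (S : Finset ι) (f : (ι → Ω₀) → ℝ)
    (ω : ι → Ω₀) : ℝ :=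
  specInt γ (gvol V S) f (gbnd θ V S ω)

lemma gG_sub (γ : Specification ι Ω₀) (θ : Ω₀) (V : Set ι) (S : Finset ι) {f g : (ι → Ω₀) → ℝ}
    (hf : IsLocal f) (hg : IsLocal g) (ω : ι → Ω₀) :
    gG γ θ V S (fun ω => f ω - g ω) ω = gG γ θ V S f ω - gG γ θ V S g ω := by
  have := γ.isProb (gvol V S) (gbnd θ V S ω)
  exact integral_sub (hf.integrable θ _) (hg.integrable θ _)

lemma gG_local (γ : Specification ι Ω₀) (θ : Ω₀) (V : Set ι) (S : Finset ι)
    (f : (ι → Ω₀) → ℝ) : IsLocal (gG γ θ V S f) := by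
  refine isLocal_of_dep θ S fun ω η h => ?_
  have : gbnd θ V S ω = gbnd θ V S η := by
    funext x
    unfold gbnd
    by_cases hx : x ∈ S
    · rw [h x hx]
    · simp [hx]
  simp only [gG, this]

lemma gG_congr (γ : Specification ι Ω₀) (θ : Ω₀) (V : Set ι) (S : Finset ι)
    (f : (ι → Ω₀) → ℝ) {ω η : ι → Ω₀} (h : ∀ x ∈ S, x ∉ V → ω x = η x) :
    gG γ θ V S f ω = gG γ θ V S f η := by
  have : gbnd θ V S ω = gbnd θ V S η := by
    funext x
    unfold gbnd
    by_cases hx : x ∈ S ∧ x ∉ V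
    · rw [h x hx.1 hx.2]
    · simp only [hx, if_false]
  simp only [gG, this]

section Order

variable [Countable ι] [LinearOrder Ω₀] [BoundedOrder Ω₀]

lemma gbnd_mono (V : Set ι) (S : Finset ι) : Monotone (gbnd (⊤ : Ω₀) V S) := by
  intro ω η h x
  unfold gbnd
  split_ifs
  · exact h x
  · exact le_rfl

lemma mono_bdd {f : (ι → Ω₀) → ℝ} (hm : Monotone f) (ω : ι → Ω₀) :
    |f ω| ≤ |f ⊤| + |f ⊥| := by
  have h1 : f ω ≤ f ⊤ := hm le_top
  have h2 : f ⊥ ≤ f ω := hm bot_le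
  rw [abs_le]
  constructor
  · have := neg_abs_le (f ⊥); have := abs_nonneg (f ⊤); linarith
  · have := le_abs_self (f ⊤); have := abs_nonneg (f ⊥); linarith

variable {γ : Specification ι Ω₀}

lemma gG_mono (hγ : MonoPreserving γ) (V : Set ι) (S : Finset ι) {f : (ι → Ω₀) → ℝ} (hf : Measurable f)
    (hm : Monotone f) : Monotone (gG γ ⊤ V S f) :=
  fun _ _ h => hγ _ f hf hm (gbnd_mono V S h)

lemma gG_anti (hγ : MonoPreserving γ) (V : Set ι) {f : (ι → Ω₀) → ℝ} (hf : Measurable f)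
    (hm : Monotone f) (ω : ι → Ω₀) : Antitone fun S => gG γ ⊤ V S f ω := by
  intro S S' hS
  dsimp only
  have hvs : gvol V S ⊆ gvol V S' := Finset.filter_subset_filter _ hS
  have hp := γ.isProb (gvol V S') (gbnd ⊤ V S' ω)
  unfold gG
  rw [← specInt_cons γ hvs hf (mono_bdd hm)]
  rw [specInt]
  have hint : Integrable (specInt γ (gvol V S) f) (γ.k (gvol V S') (gbnd ⊤ V S' ω)) :=
    bdd_integrable (specInt_meas γ _ hf (mono_bdd hm)) (specInt_bdd γ _ (mono_bdd hm))
  have : ∫ _x, specInt γ (gvol V S) f (gbnd ⊤ V S ω) ∂(γ.k (gvol V S') (gbnd ⊤ V S' ω))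
      = specInt γ (gvol V S) f (gbnd ⊤ V S ω) := by simp
  rw [← this]
  refine integral_mono_ae hint (integrable_const _) ?_
  filter_upwards [spec_ae γ (gvol V S') (gbnd ⊤ V S' ω)] with η hη
  refine hγ _ f hf hm fun x => ?_
  by_cases hx : x ∈ S ∧ x ∉ V
  · rw [hη x (by simp [gvol, hx.2])]
    simp [gbnd, hx, hS hx.1]
  · simp only [gbnd, hx, if_false]; exact le_top

lemma gG_tendsto (hγ : MonoPreserving γ) (V : Set ι) {f : (ι → Ω₀) → ℝ} (hf : IsLocal f) (ω : ι → Ω₀) :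
    ∃ L, Tendsto (fun S => gG γ ⊤ V S f ω) atTop (𝓝 L) := by
  have main : ∀ f, IsLocal f → Monotone f →
      ∃ L, Tendsto (fun S => gG γ ⊤ V S f ω) atTop (𝓝 L) := by
    intro f hf hm
    refine ⟨_, tendsto_atTop_ciInf (gG_anti hγ V hf.meas hm ω) ?_⟩
    refine ⟨-(|f ⊤| + |f ⊥|), ?_⟩
    rintro _ ⟨S, rfl⟩
    exact (abs_le.1 (specInt_bdd γ _ (mono_bdd hm) _)).1
  obtain ⟨g, h, hg, hh, mg, mh, rfl⟩ := hf.decomp ⊤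
  obtain ⟨L, hL⟩ := main g hg mg
  obtain ⟨M, hM⟩ := main h hh mh
  refine ⟨L - M, ?_⟩
  simp only [gG_sub γ ⊤ V _ hg hh]
  exact hL.sub hM

lemma gK_exists (hγ : MonoPreserving γ) (V : Set ι) (ω : ι → Ω₀) : ∃ ν : Measure (ι → Ω₀), IsProbabilityMeasure ν ∧
    ∀ f, IsLocal f → Tendsto (fun S => gG γ ⊤ V S f ω) atTop (𝓝 (∫ η, f η ∂ν)) := by
  let _ : TopologicalSpace Ω₀ := ⊥
  have _ : DiscreteTopology Ω₀ := ⟨rfl⟩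
  let P : Finset ι → ProbabilityMeasure (ι → Ω₀) := fun S =>
    ⟨γ.k (gvol V S) (gbnd ⊤ V S ω), γ.isProb _ _⟩
  let U : Ultrafilter (Finset ι) := Ultrafilter.of atTop
  have hU : (U : Filter (Finset ι)) ≤ atTop := Ultrafilter.of_le _
  obtain ⟨ν, -, hν⟩ := isCompact_univ.ultrafilter_le_nhds (U.map P) (by simp)
  have hT : Tendsto P U (𝓝 ν) := hν
  refine ⟨ν, ν.2, fun f hf => ?_⟩
  obtain ⟨L, hL⟩ := gG_tendsto hγ V hf ω
  obtain ⟨C, hC⟩ := hf.bdd ⊤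
  let F : BoundedContinuousFunction (ι → Ω₀) ℝ :=
    BoundedContinuousFunction.ofNormedAddCommGroup f (hf.cont ⊤) C hC
  have h1 := (ProbabilityMeasure.tendsto_iff_forall_integral_tendsto.1 hT) F
  have h2 : L = ∫ η, f η ∂(ν : Measure (ι → Ω₀)) := tendsto_nhds_unique (hL.mono_left hU) h1
  rwa [← h2]

/-- The global kernel for the (possibly infinite) volume `V`. -/
def gK (hγ : MonoPreserving γ) (V : Set ι) (ω : ι → Ω₀) : Measure (ι → Ω₀) :=
  Classical.choose (gK_exists hγ V ω)

instance gK_prob (hγ : MonoPreserving γ) (V : Set ι) (ω : ι → Ω₀) :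
    IsProbabilityMeasure (gK hγ V ω) :=
  (Classical.choose_spec (gK_exists hγ V ω)).1

lemma gK_lim (hγ : MonoPreserving γ) (V : Set ι) (ω : ι → Ω₀) {f : (ι → Ω₀) → ℝ}
    (hf : IsLocal f) :
    Tendsto (fun S => gG γ ⊤ V S f ω) atTop (𝓝 (∫ η, f η ∂gK hγ V ω)) :=
  (Classical.choose_spec (gK_exists hγ V ω)).2 f hf

lemma gK_le (hγ : MonoPreserving γ) (V : Set ι) (ω : ι → Ω₀) {f : (ι → Ω₀) → ℝ}
    (hf : IsLocal f) (hm : Monotone f) (S : Finset ι) :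
    ∫ η, f η ∂gK hγ V ω ≤ gG γ ⊤ V S f ω :=
  (gG_anti hγ V hf.meas hm ω).le_of_tendsto (gK_lim hγ V ω hf) S

lemma gK_mono (hγ : MonoPreserving γ) (V : Set ι) {ω ω' : ι → Ω₀} (h : ω ≤ ω')
    {f : (ι → Ω₀) → ℝ} (hf : IsLocal f) (hm : Monotone f) :
    ∫ η, f η ∂gK hγ V ω ≤ ∫ η, f η ∂gK hγ V ω' :=
  le_of_tendsto_of_tendsto' (gK_lim hγ V ω hf) (gK_lim hγ V ω' hf)
    fun S => gG_mono hγ V S hf.meas hm h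

lemma gK_congr (hγ : MonoPreserving γ) (V : Set ι) {ω ω' : ι → Ω₀}
    (h : ∀ x, x ∉ V → ω x = ω' x) : gK hγ V ω = gK hγ V ω' := by
  refine ext_of_local ⊤ fun f hf _ => ?_
  refine tendsto_nhds_unique (gK_lim hγ V ω hf) ?_
  refine (gK_lim hγ V ω' hf).congr fun S => ?_
  exact gG_congr γ ⊤ V S f fun x _ hx => (h x hx).symm

lemma ind_local (θ : Ω₀) {A : Set (ι → Ω₀)} (Δ : Finset ι)
    (h : ∀ ω η, (∀ x ∈ Δ, ω x = η x) → (ω ∈ A ↔ η ∈ A)) :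
    IsLocal (A.indicator (1 : (ι → Ω₀) → ℝ)) := by
  refine isLocal_of_dep θ Δ fun ω η hx => ?_
  have := h ω η hx
  by_cases hω : ω ∈ A
  · simp [hω, this.1 hω]
  · simp [hω, mt this.2 hω]

lemma gK_ae (hγ : MonoPreserving γ) (V : Set ι) (ω : ι → Ω₀) :
    ∀ᵐ η ∂gK hγ V ω, ∀ x, x ∉ V → η x = ω x := by
  rw [ae_all_iff]
  intro x
  by_cases hx : x ∈ V
  · simp [hx]
  let A : Set (ι → Ω₀) := {η | η x = ω x}
  have hA : MeasurableSet A := 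
    measurableSet_eq_fun (measurable_pi_apply x) measurable_const
  have hl : IsLocal (A.indicator (1 : (ι → Ω₀) → ℝ)) := by
    refine ind_local ⊤ {x} fun ξ η h => ?_
    have := h x (by simp)
    show ξ x = ω x ↔ η x = ω x
    rw [this]
  have h1 := gK_lim hγ V ω hl
  rw [integral_indicator_one hA] at h1
  have h2 : Tendsto (fun S => gG γ ⊤ V S (A.indicator (1 : (ι → Ω₀) → ℝ)) ω) atTop (𝓝 1) := by
    refine tendsto_const_nhds.congr' ?_
    filter_upwards [eventually_ge_atTop {x}] with S hS
    have hxS : x ∈ S := hS (by simp)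
    have hp := γ.isProb (gvol V S) (gbnd ⊤ V S ω)
    have h3 : ∫ η, A.indicator (1 : (ι → Ω₀) → ℝ) η ∂(γ.k (gvol V S) (gbnd ⊤ V S ω))
        = ∫ _η, (1 : ℝ) ∂(γ.k (gvol V S) (gbnd ⊤ V S ω)) := by
      refine integral_congr_ae ?_
      filter_upwards [spec_ae γ (gvol V S) (gbnd ⊤ V S ω)] with η hη
      have h4 : η ∈ A := by
        show η x = ω x
        rw [hη x (by simp [gvol, hx])]
        simp [gbnd, hxS, hx]
      simp [h4]
    unfold gG specInt
    rw [h3]; simp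
  have h3 : (gK hγ V ω).real A = 1 := tendsto_nhds_unique h1 h2
  have h4 : gK hγ V ω A = 1 := by
    rw [measureReal_def] at h3
    rw [← ENNReal.ofReal_toReal (measure_ne_top (gK hγ V ω) A), h3, ENNReal.ofReal_one]
  have h5 : ∀ᵐ η ∂gK hγ V ω, η ∈ A := (mem_ae_iff_prob_eq_one hA).2 h4
  filter_upwards [h5] with η hη _ using hη

lemma gK_int_meas (hγ : MonoPreserving γ) (V : Set ι) {f : (ι → Ω₀) → ℝ} (hf : IsLocal f) :
    Measurable fun ω => ∫ η, f η ∂gK hγ V ω := by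
  refine measurable_of_tendsto_metrizable' (atTop : Filter (Finset ι))
    (fun S => (gG_local γ ⊤ V S f).meas) ?_
  rw [tendsto_pi_nhds]
  exact fun ω => gK_lim hγ V ω hf

lemma gK_meas (hγ : MonoPreserving γ) (V : Set ι) : Measurable (gK hγ V) := by
  refine Measurable.measure_of_isPiSystem_of_isProbabilityMeasure
    generateFrom_measurableCylinders.symm isPiSystem_measurableCylinders ?_
  intro A hA
  obtain ⟨Δ, S, hS, rfl⟩ := (mem_measurableCylinders _).1 hA
  have hm : MeasurableSet (cylinder Δ S : Set (ι → Ω₀)) := hS.cylinder Δ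
  have hl : IsLocal ((cylinder Δ S : Set (ι → Ω₀)).indicator (1 : (ι → Ω₀) → ℝ)) := by
    refine ind_local ⊤ Δ fun ω η h => ?_
    simp only [mem_cylinder]
    have : Δ.restrict ω = Δ.restrict η := by funext x; exact h x x.2
    rw [this]
  have h1 := (gK_int_meas hγ V hl).ennreal_ofReal
  convert h1 using 1
  funext ω
  rw [integral_indicator_one hm, measureReal_def, ENNReal.ofReal_toReal (measure_ne_top _ _)]

lemma gK_cons (hγ : MonoPreserving γ) {U V : Set ι} (hUV : U ⊆ V) (ω : ι → Ω₀) :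
    (gK hγ V ω).bind (gK hγ U) = gK hγ V ω := by
  have hP : IsProbabilityMeasure ((gK hγ V ω).bind (gK hγ U)) :=
    isProbabilityMeasure_bind (gK_meas hγ U).aemeasurable
      (Eventually.of_forall fun η => gK_prob hγ U η)
  refine ext_of_local ⊤ fun f hf hm => ?_
  rw [(integral_bind_kernel (gK hγ V ω) _ (gK_meas hγ U) (gK_prob hγ U) hf.meas (mono_bdd hm)).2]
  have hlim1 : Tendsto (fun S => ∫ η, gG γ ⊤ U S f η ∂gK hγ V ω) atTop
      (𝓝 (∫ η, ∫ ξ, f ξ ∂gK hγ U η ∂gK hγ V ω)) := by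
    refine tendsto_integral_filter_of_dominated_convergence (fun _ => |f ⊤| + |f ⊥|)
      (Eventually.of_forall fun S => (gG_local γ ⊤ U S f).meas.aestronglyMeasurable)
      (Eventually.of_forall fun S => Eventually.of_forall fun η =>
        specInt_bdd γ _ (mono_bdd hm) _) (integrable_const _)
      (Eventually.of_forall fun η => gK_lim hγ U η hf)
  refine tendsto_nhds_unique hlim1 ?_
  refine tendsto_of_tendsto_of_tendsto_of_le_of_le tendsto_const_nhds (gK_lim hγ V ω hf) ?_ ?_
  · intro S
    dsimp only
    refine le_of_tendsto_of_tendsto (gK_lim hγ V ω hf)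
      (gK_lim hγ V ω (gG_local γ ⊤ U S f)) ?_
    filter_upwards [eventually_ge_atTop S] with S' hS'
    have hsub : gvol U S ⊆ gvol V S' := by
      intro x hx
      simp only [gvol, Finset.mem_filter] at hx ⊢
      exact ⟨hS' hx.1, hUV hx.2⟩
    have hp := γ.isProb (gvol V S') (gbnd ⊤ V S' ω)
    unfold gG
    rw [← specInt_cons γ hsub hf.meas (mono_bdd hm)]
    refine integral_mono
      (bdd_integrable (specInt_meas γ _ hf.meas (mono_bdd hm)) (specInt_bdd γ _ (mono_bdd hm)))
      ((gG_local γ ⊤ U S f).integrable ⊤ _) fun η => ?_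
    refine hγ _ f hf.meas hm fun x => ?_
    unfold gbnd
    split_ifs
    · exact le_rfl
    · exact le_top
  · intro S
    dsimp only
    refine (gK_le hγ V ω (gG_local γ ⊤ U S f) (gG_mono hγ U S hf.meas hm) S).trans_eq ?_
    have hsub : gvol U S ⊆ gvol V S := by
      intro x hx
      simp only [gvol, Finset.mem_filter] at hx ⊢
      exact ⟨hx.1, hUV hx.2⟩
    conv_rhs => rw [gG, ← specInt_cons γ hsub hf.meas (mono_bdd hm)]
    rw [gG, specInt, specInt]
    refine integral_congr_ae ?_
    filter_upwards [spec_ae γ (gvol V S) (gbnd ⊤ V S ω)] with η hη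
    rw [gG, specInt, specInt]
    rw [spec_congr γ (gvol U S) (ω := gbnd ⊤ U S η) (ω' := η)]
    intro x hx
    simp only [gvol, Finset.mem_filter] at hx hη
    by_cases hxS : x ∈ S
    · have : x ∉ U := fun h => hx ⟨hxS, h⟩
      simp [gbnd, hxS, this]
    · rw [hη x (fun h => hxS h.1)]
      simp [gbnd, hxS]

lemma gK_univ (hγ : MonoPreserving γ) {μ : Measure (ι → Ω₀)}
    (hμ : IsLimitWithBoundary γ (fun _ => (⊤ : Ω₀)) μ) (ω : ι → Ω₀) :
    gK hγ Set.univ ω = μ := by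
  have := hμ.1
  refine ext_of_local ⊤ fun f hf _ => ?_
  refine tendsto_nhds_unique (gK_lim hγ _ ω hf) ((hμ.2 f hf).congr fun S => ?_)
  have h1 : gvol Set.univ S = S := by simp [gvol]
  have h2 : gbnd (⊤ : Ω₀) Set.univ S ω = fun _ => ⊤ := by funext x; simp [gbnd]
  rw [gG, h1, h2]

lemma gK_qloc (hγ : MonoPreserving γ) (V : Set ι) {α : Type*} {l : Filter α} (ω : ι → Ω₀)
    (u : α → ι → Ω₀) (hle : ∀ a, ω ≤ u a)
    (hev : ∀ S : Finset ι, ∀ᶠ a in l, ∀ x ∈ S, x ∉ V → u a x = ω x)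
    {f : (ι → Ω₀) → ℝ} (hf : IsLocal f) :
    Tendsto (fun a => ∫ η, f η ∂gK hγ V (u a)) l (𝓝 (∫ η, f η ∂gK hγ V ω)) := by
  have main : ∀ f, IsLocal f → Monotone f →
      Tendsto (fun a => ∫ η, f η ∂gK hγ V (u a)) l (𝓝 (∫ η, f η ∂gK hγ V ω)) := by
    intro f hf hm
    refine tendsto_order.2 ⟨fun b hb => Eventually.of_forall fun a =>
      hb.trans_le (gK_mono hγ V (hle a) hf hm), fun b hb => ?_⟩
    obtain ⟨S, hS⟩ := ((tendsto_order.1 (gK_lim hγ V ω hf)).2 b hb).exists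
    filter_upwards [hev S] with a ha
    refine (gK_le hγ V (u a) hf hm S).trans_lt ?_
    rwa [gG_congr γ ⊤ V S f ha]
  obtain ⟨g, h, hg, hh, mg, mh, rfl⟩ := hf.decomp ⊤
  have := (main g hg mg).sub (main h hh mh)
  refine (this.congr fun a => ?_).trans (le_of_eq ?_)
  · rw [integral_sub (hg.integrable ⊤ _) (hh.integrable ⊤ _)]
  · rw [integral_sub (hg.integrable ⊤ _) (hh.integrable ⊤ _)]

/-- Projection to `D`. -/
def gproj (D : Set ι) (ω : ι → Ω₀) : ↥D → Ω₀ := fun x => ω (x : ι)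

/-- Extension of a configuration on `D` by the constant `e`. -/
def gext (e : Ω₀) (D : Set ι) (ω : ↥D → Ω₀) : ι → Ω₀ :=
  fun x => if h : x ∈ D then ω ⟨x, h⟩ else e

/-- The volume `Dᶜ ∪ Λ`. -/
def gV (D : Set ι) (Λ : Finset ↥D) : Set ι := {x | ∀ h : x ∈ D, (⟨x, h⟩ : ↥D) ∈ Λ}

lemma gproj_meas (D : Set ι) : Measurable (gproj D : (ι → Ω₀) → (↥D → Ω₀)) :=
  measurable_pi_lambda _ fun _ => measurable_pi_apply _

lemma gext_meas (e : Ω₀) (D : Set ι) : Measurable (gext e D) := by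
  refine measurable_pi_lambda _ fun x => ?_
  by_cases hx : x ∈ D
  · simp only [gext, hx, dite_true]; exact measurable_pi_apply _
  · simp only [gext, hx, dite_false]; exact measurable_const

lemma notMem_gV {D : Set ι} {Λ : Finset ↥D} {x : ι} :
    x ∉ gV D Λ ↔ ∃ h : x ∈ D, (⟨x, h⟩ : ↥D) ∉ Λ := by
  constructor
  · intro h
    by_contra hc
    push Not at hc
    exact h hc
  · rintro ⟨h, hΛ⟩ hV
    exact hΛ (hV h)

lemma local_comp_proj (θ : Ω₀) {D : Set ι} {f : (↥D → Ω₀) → ℝ} (hf : IsLocal f) :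
    IsLocal fun ω : ι → Ω₀ => f (gproj D ω) := by
  obtain ⟨Δ, hΔ⟩ := hf.dep
  refine isLocal_of_dep θ (Δ.image (fun x : ↥D => (x : ι))) fun ω η h => hΔ _ _ fun x hx => ?_
  exact h x (Finset.mem_image_of_mem _ hx)

/-- Kernel of the projected specification. -/
def gk (hγ : MonoPreserving γ) (e : Ω₀) (D : Set ι) (Λ : Finset ↥D) (ω : ↥D → Ω₀) :
    Measure (↥D → Ω₀) :=
  (gK hγ (gV D Λ) (gext e D ω)).map (gproj D)

lemma gk_prob (hγ : MonoPreserving γ) (e : Ω₀) (D : Set ι) (Λ : Finset ↥D) (ω : ↥D → Ω₀) :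
    IsProbabilityMeasure (gk hγ e D Λ ω) :=
  Measure.isProbabilityMeasure_map (gproj_meas D).aemeasurable

lemma gk_meas (hγ : MonoPreserving γ) (e : Ω₀) (D : Set ι) (Λ : Finset ↥D) :
    Measurable (gk hγ e D Λ) :=
  (Measure.measurable_map _ (gproj_meas D)).comp ((gK_meas hγ _).comp (gext_meas e D))

lemma gk_congr (hγ : MonoPreserving γ) (e : Ω₀) (D : Set ι) (Λ : Finset ↥D) {ω ω' : ↥D → Ω₀}
    (h : ∀ x, x ∉ Λ → ω x = ω' x) : gk hγ e D Λ ω = gk hγ e D Λ ω' := by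
  unfold gk
  rw [gK_congr hγ (gV D Λ) (ω := gext e D ω) (ω' := gext e D ω')]
  intro x hx
  obtain ⟨hD, hΛ⟩ := notMem_gV.1 hx
  simp only [gext, hD, dite_true]
  exact h _ hΛ

lemma gk_bind (hγ : MonoPreserving γ) (e : Ω₀) (D : Set ι) (Λ : Finset ↥D)
    {m : Measure (ι → Ω₀)} (hm : m.bind (gK hγ (gV D Λ)) = m) :
    (m.map (gproj D)).bind (gk hγ e D Λ) = m.map (gproj D) := by
  ext A hA
  have hA' : MeasurableSet (gproj D ⁻¹' A : Set (ι → Ω₀)) := gproj_meas D hA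
  rw [Measure.bind_apply hA (gk_meas hγ e D Λ).aemeasurable,
    lintegral_map (f := fun a => gk hγ e D Λ a A)
      ((Measure.measurable_coe hA).comp (gk_meas hγ e D Λ)) (gproj_meas D),
    Measure.map_apply (gproj_meas D) hA]
  conv_rhs => rw [← hm, Measure.bind_apply hA' (gK_meas hγ _).aemeasurable]
  refine lintegral_congr fun η => ?_
  unfold gk
  rw [Measure.map_apply (gproj_meas D) hA]
  rw [gK_congr hγ (gV D Λ) (ω := gext e D (gproj D η)) (ω' := η)]
  intro x hx
  obtain ⟨hD, hΛ⟩ := notMem_gV.1 hx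
  simp [gext, gproj, hD]

/-- The projected specification. -/
def gSpec (hγ : MonoPreserving γ) (e : Ω₀) (D : Set ι) : Specification ↥D Ω₀ where
  k := gk hγ e D
  isProb := gk_prob hγ e D
  meas := by
    intro Λ A hA
    refine cyl_measurable (f := fun ω => gk hγ e D Λ ω A) e
      ((Measure.measurable_coe hA).comp (gk_meas hγ e D Λ)) fun ω => ?_
    refine congrArg (fun m : Measure (↥D → Ω₀) => m A) (gk_congr hγ e D Λ fun x hx => ?_)
    simp [hx]
  proper := by
    intro Λ B hB ω
    have hB' := cyl_le _ _ hB
    have hae : ∀ᵐ η ∂gK hγ (gV D Λ) (gext e D ω), (gproj D η ∈ B ↔ ω ∈ B) := by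
      filter_upwards [gK_ae hγ (gV D Λ) (gext e D ω)] with η hη
      refine cyl_mem_iff hB fun x hx => ?_
      have h1 := hη x (notMem_gV.2 ⟨x.2, hx⟩)
      simpa [gext, gproj] using h1
    unfold gk
    rw [Measure.map_apply (gproj_meas D) hB']
    by_cases hω : ω ∈ B
    · rw [Set.indicator_of_mem hω, Pi.one_apply]
      refine (mem_ae_iff_prob_eq_one (gproj_meas D hB')).1 ?_
      filter_upwards [hae] with η hη using hη.2 hω
    · rw [Set.indicator_of_notMem hω]
      refine measure_eq_zero_iff_ae_notMem.2 ?_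
      filter_upwards [hae] with η hη h using hω (hη.1 h)
  consistent := by
    intro Λ Λ' hs ω
    refine gk_bind hγ e D Λ (gK_cons hγ ?_ _)
    intro x hx h
    exact hs (hx h)

lemma gSpec_int (hγ : MonoPreserving γ) (e : Ω₀) (D : Set ι) (Λ : Finset ↥D)
    {f : (↥D → Ω₀) → ℝ} (hf : Measurable f) (ω : ↥D → Ω₀) :
    specInt (gSpec hγ e D) Λ f ω = ∫ η, f (gproj D η) ∂gK hγ (gV D Λ) (gext e D ω) :=
  integral_map (gproj_meas D).aemeasurable hf.aestronglyMeasurable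

lemma plus_exists (hγ : MonoPreserving γ) {μ : Measure (ι → Ω₀)}
    (hμ : IsLimitWithBoundary γ (fun _ => (⊤ : Ω₀)) μ) (e : Ω₀) (D : Set ι) :
    ∃ Γ : Specification ↥D Ω₀, MonoPreserving Γ ∧
      IsGibbs Γ (μ.map fun ω (x : ↥D) => ω (x : ι)) ∧
      SpecQuasilocalInDir Γ (fun _ => (⊤ : Ω₀)) ∧
      ∀ Λ ω, ∃ ν : Measure (ι → Ω₀), IsProbabilityMeasure ν ∧
        (∀ f : (↥D → Ω₀) → ℝ, Measurable f → specInt Γ Λ f ω = ∫ η, f (gproj D η) ∂ν) ∧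
        ∀ f, IsLocal f → Tendsto (fun S => gG γ ⊤ (gV D Λ) S f (gext e D ω)) atTop
          (𝓝 (∫ η, f η ∂ν)) := by
  refine ⟨gSpec hγ e D, ?_, ?_, ?_, ?_⟩
  · intro Λ f hf hm ω ω' hle
    rw [gSpec_int hγ e D Λ hf, gSpec_int hγ e D Λ hf]
    refine dom_fun (fun g hg mg => gK_mono hγ _ ?_ hg mg) (hf.comp (gproj_meas D))
      (fun η η' h => hm fun x => h x)
    intro x
    unfold gext
    split_ifs
    · exact hle _
    · exact le_rfl
  · intro Λ
    refine gk_bind hγ e D Λ ?_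
    rw [← gK_univ hγ hμ ⊤]
    exact gK_cons hγ (Set.subset_univ _) _
  · intro Λ f hf ω
    simp only [gSpec_int hγ e D Λ hf.meas]
    refine gK_qloc hγ (gV D Λ) (gext e D ω) _ ?_ ?_ (local_comp_proj ⊤ hf)
    · intro S x
      unfold gext splice
      split_ifs
      · exact le_rfl
      · exact le_top
      · exact le_rfl
    · intro T
      have hfin : ∃ S₀ : Finset ↥D, ∀ x : ↥D, (x : ι) ∈ T → x ∈ S₀ := by
        refine ⟨T.subtype (· ∈ D), fun x hx => ?_⟩
        simpa using hx
      obtain ⟨S₀, hS₀⟩ := hfin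
      filter_upwards [eventually_ge_atTop S₀] with S hS x hxT hxV
      obtain ⟨hD, hΛ⟩ := notMem_gV.1 hxV
      have : (⟨x, hD⟩ : ↥D) ∈ S := hS (hS₀ ⟨x, hD⟩ hxT)
      simp [gext, splice, hD, this]
  · intro Λ ω
    exact ⟨gK hγ (gV D Λ) (gext e D ω), inferInstance,
      fun f hf => gSpec_int hγ e D Λ hf ω, fun f hf => gK_lim hγ _ _ hf⟩

lemma minus_exists (hγ : MonoPreserving γ) {μ : Measure (ι → Ω₀)}
    (hμ : IsLimitWithBoundary γ (fun _ => (⊥ : Ω₀)) μ) (e : Ω₀) (D : Set ι) :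
    ∃ Γ : Specification ↥D Ω₀, MonoPreserving Γ ∧
      IsGibbs Γ (μ.map fun ω (x : ↥D) => ω (x : ι)) ∧
      SpecQuasilocalInDir Γ (fun _ => (⊥ : Ω₀)) ∧
      ∀ Λ ω, ∃ ν : Measure (ι → Ω₀), IsProbabilityMeasure ν ∧
        (∀ f : (↥D → Ω₀) → ℝ, Measurable f → specInt Γ Λ f ω = ∫ η, f (gproj D η) ∂ν) ∧
        ∀ f, IsLocal f → Tendsto (fun S => gG γ ⊥ (gV D Λ) S f (gext e D ω)) atTop
          (𝓝 (∫ η, f η ∂ν)) := by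
  have hmono' : @MonoPreserving ι Ω₀ _
      (OrderDual.instLinearOrder Ω₀).toPartialOrder.toPreorder γ := by
    intro Λ f hf hm ω η hle
    have h1 : Monotone fun ω => - f ω := fun a b hab =>
      neg_le_neg (hm (show ∀ i, a i ≤ b i from hab))
    have h2 := hγ Λ (fun ω => - f ω) hf.neg h1 (show η ≤ ω from hle)
    simp only [specInt, integral_neg, neg_le_neg_iff] at h2
    exact h2
  obtain ⟨Γm, hm1, hm2, hm3, hm4⟩ := @plus_exists ι Ω₀ _ _ _ _ (OrderDual.instLinearOrder Ω₀)
    (OrderDual.instBoundedOrder Ω₀) γ hmono' μ hμ e D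
  refine ⟨Γm, ?_, hm2, hm3, hm4⟩
  intro Λ f hf hm ω η hle
  have h2 := hm1 Λ (fun ω => - f ω) hf.neg (fun a b hab => 
      neg_le_neg (hm (show b ≤ a from hab))) (show ∀ i, ω i ≤ η i from hle)
  simp only [specInt, integral_neg, neg_le_neg_iff] at h2
  exact h2

end Order

end Helpers

/-- For every infinite `D ⊂ 𝕃`, the projections to `Ω_D` of the extremal states of a
monotonicity-preserving specification are consistent with monotonicity-preserving
specifications `Γ^{(D,±)}` on `Ω_D`, with `Γ^{(D,−)}_Λ f ≤ Γ^{(D,+)}_Λ f` for every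
increasing `f`, `Γ^{(D,+)}` right continuous and `Γ^{(D,−)}` left continuous. -/
theorem projected_extremal_measures_consistent
    {Ω₀ : Type*} [Fintype Ω₀] [MeasurableSpace Ω₀] [DiscreteMeasurableSpace Ω₀]
    [LinearOrder Ω₀] [BoundedOrder Ω₀] {d : ℕ}
    (γ : Specification (Site d) Ω₀) (hmono : MonoPreserving γ)
    (μp μm : Measure (Site d → Ω₀))
    (hμp : IsLimitWithBoundary γ (fun _ => (⊤ : Ω₀)) μp)
    (hμm : IsLimitWithBoundary γ (fun _ => (⊥ : Ω₀)) μm) :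
    ∀ D : Set (Site d), D.Infinite →
      ∃ Γp Γm : Specification (↥D) Ω₀,
        MonoPreserving Γp ∧ MonoPreserving Γm ∧
        IsGibbs Γp (μp.map fun ω (x : ↥D) => ω (x : Site d)) ∧
        IsGibbs Γm (μm.map fun ω (x : ↥D) => ω (x : Site d)) ∧
        (∀ (Λ : Finset ↥D) (f : (↥D → Ω₀) → ℝ), Measurable f → Monotone f →
          ∀ ω, specInt Γm Λ f ω ≤ specInt Γp Λ f ω) ∧
        SpecQuasilocalInDir Γp (fun _ => (⊤ : Ω₀)) ∧
        SpecQuasilocalInDir Γm (fun _ => (⊥ : Ω₀)) := by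
  intro D _
  obtain ⟨Γp, hp1, hp2, hp3, hp4⟩ := plus_exists hmono hμp (⊤ : Ω₀) D
  obtain ⟨Γm, hm1, hm2, hm3, hm4⟩ := minus_exists hmono hμm (⊤ : Ω₀) D
  refine ⟨Γp, Γm, hp1, hm1, hp2, hm2, ?_, hp3, hm3⟩
  · intro Λ f hf hm ω
    obtain ⟨ν, hν, hν1, hν2⟩ := hp4 Λ ω
    obtain ⟨ν', hν', hν1', hν2'⟩ := hm4 Λ ω
    rw [hν1 f hf, hν1' f hf]
    refine dom_fun (fun g hg mg => ?_) (hf.comp (gproj_meas D)) (fun η η' h => hm fun x => h x)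
    refine le_of_tendsto_of_tendsto' (hν2' g hg) (hν2 g hg) fun S => ?_
    refine hmono _ g hg.meas mg fun x => ?_
    unfold gbnd
    split_ifs
    · exact le_rfl
    · exact bot_le

end
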